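/- For every τ ∈ 𝔯₋ˣ, the coadjoint isotropy subalgebra 𝔫_τ = {v ∈ 𝔫 : Φ([v,τ]) = 0} equals 𝔯; in particular 𝔫_τ is independent of the choice of τ ∈ 𝔯₋ˣ. -/

import Mathlib

open scoped InnerProductSpace BigOperators

structure RootSystemData (V : Type*) [NormedAddCommGroup V] [InnerProductSpace ℝ V] where
  Δ : Set V
  finite : Δ.Finite
  span_top : Submodule.span ℝ Δ = ⊤
  zero_not_mem : (0 : V) ∉ Δ
  neg_mem : ∀ α ∈ Δ, -α ∈ Δ
  reduced : ∀ α ∈ Δ, ∀ t : ℝ, t • α ∈ Δ → t = 1 ∨ t = -1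
  crystal : ∀ α ∈ Δ, ∀ β ∈ Δ, ∃ n : ℤ, 2 * ⟪α, β⟫_ℝ = (n : ℝ) * ⟪β, β⟫_ℝ
  reflect_mem : ∀ α ∈ Δ, ∀ β ∈ Δ, α - (2 * ⟪α, β⟫_ℝ / ⟪β, β⟫_ℝ) • β ∈ Δ
  Pos : Set V
  pos_subset : Pos ⊆ Δ
  mem_or_neg : ∀ α ∈ Δ, α ∈ Pos ∨ -α ∈ Pos
  not_neg_mem : ∀ α ∈ Pos, -α ∉ Pos
  pos_add : ∀ α ∈ Pos, ∀ β ∈ Pos, α + β ∈ Δ → α + β ∈ Pos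

namespace RootSystemData

variable {V : Type*} [NormedAddCommGroup V] [InnerProductSpace ℝ V] (R : RootSystemData V)

/-- The set of simple roots: indecomposable positive roots. -/
def Simple : Set V := {α ∈ R.Pos | ¬ ∃ β ∈ R.Pos, ∃ γ ∈ R.Pos, α = β + γ}

/-- The support `Π(φ)` of a positive root: the simple roots needed to express `φ`. -/
def support (φ : V) : Set V := {α ∈ R.Simple | φ ∉ Submodule.span ℝ (R.Simple \ {α})}

/-- The root subsystem `Δ(φ)`: all roots lying in the span of the support of `φ`. -/
def sub (φ : V) : Set V := {ψ ∈ R.Δ | ψ ∈ Submodule.span ℝ (R.support φ)}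

/-- The positive roots `Δ(φ)₊` of the subsystem `Δ(φ)`. -/
def posSub (φ : V) : Set V := R.sub φ ∩ R.Pos

/-- `x` is a nonnegative integer combination of positive roots. -/
def NonnegComb (x : V) : Prop :=
  ∃ c : V →₀ ℕ, ↑c.support ⊆ R.Pos ∧ x = c.sum fun α n => (n : ℝ) • α

/-- `β` is the highest root of the subset `S`. -/
def IsHighest (S : Set V) (β : V) : Prop :=
  β ∈ S ∧ β ∈ R.Pos ∧ ∀ ψ ∈ S, R.NonnegComb (β - ψ)

/-- `β` is locally high: it is the highest root of `Δ(β)`. -/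
def LocallyHigh (β : V) : Prop := β ∈ R.Pos ∧ R.IsHighest (R.sub β) β

/-- `E(β) = {φ ∈ Δ(β) : (φ,β) > 0}`. -/
def E (β : V) : Set V := {φ ∈ R.sub β | 0 < ⟪φ, β⟫_ℝ}

/-- `Δ(β)° = {φ ∈ Δ(β) : (φ,β) = 0}`. -/
def orth (β : V) : Set V := {φ ∈ R.sub β | ⟪φ, β⟫_ℝ = 0}

/-- Strong orthogonality of two roots. -/
def StronglyOrth (φ ψ : V) : Prop := φ + ψ ∉ R.Δ ∧ φ - ψ ∉ R.Δ


/-- Half the sum of the positive roots of `Δ(β)`. -/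
noncomputable def rho (β : V) : V := (2⁻¹ : ℝ) • ∑ᶠ φ ∈ R.posSub β, φ

/-- The dual Coxeter number of `Δ(β)`, `⟨ρ_β, β^∨⟩ + 1`. -/
noncomputable def dualCoxeter (β : V) : ℝ := 2 * ⟪R.rho β, β⟫_ℝ / ⟪β, β⟫_ℝ + 1

end RootSystemData

/-- A finite set of vectors is irreducible if it is nonempty and admits no splitting into
two nonempty mutually orthogonal pieces. -/
def IsIrred {V : Type*} [NormedAddCommGroup V] [InnerProductSpace ℝ V] (S : Set V) : Prop :=
  S.Nonempty ∧ ¬ ∃ A B : Set V, A ∪ B = S ∧ A ∩ B = ∅ ∧ A.Nonempty ∧ B.Nonempty ∧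
    ∀ a ∈ A, ∀ b ∈ B, ⟪a, b⟫_ℝ = 0

/-- `C` is an irreducible component of `S`. -/
def IsComponent {V : Type*} [NormedAddCommGroup V] [InnerProductSpace ℝ V]
    (S C : Set V) : Prop :=
  C ⊆ S ∧ IsIrred C ∧ ∀ a ∈ C, ∀ b ∈ S \ C, ⟪a, b⟫_ℝ = 0

/-- The reflection `s_β` in the (co)vector `β`. -/
noncomputable def reflectRoot {V : Type*} [NormedAddCommGroup V] [InnerProductSpace ℝ V]
    (β v : V) : V := v - (2 * ⟪v, β⟫_ℝ / ⟪β, β⟫_ℝ) • β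

namespace RootSystemData

variable {V : Type*} [NormedAddCommGroup V] [InnerProductSpace ℝ V] (R : RootSystemData V)

/-- A chain cascade: a nonempty list whose head is the highest root of an irreducible
component of `Δ`, and each subsequent entry is the highest root of an irreducible component
of `Δ(previous)°`. -/
def IsChainCascade (l : List V) : Prop :=
  l ≠ [] ∧
  (∀ b ∈ l.head?, ∃ C, IsComponent R.Δ C ∧ R.IsHighest C b) ∧
  l.Chain' fun γ δ => ∃ C, IsComponent (R.orth γ) C ∧ R.IsHighest C δ

/-- The cascade `ℬ` of roots: all positive roots belonging to some chain cascade. -/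
def cascade : Set V := {β | ∃ l, R.IsChainCascade l ∧ β ∈ l}

/-- `l` is the chain cascade `C(φ)` associated to the positive root `φ`. -/
def IsCascadeChainOf (φ : V) (l : List V) : Prop :=
  R.IsChainCascade l ∧ (∀ β ∈ l, φ ∈ R.sub β) ∧
  (∀ β ∈ l.dropLast, ⟪φ, β⟫_ℝ = 0) ∧ ∀ β ∈ l.getLast?, 0 < ⟪φ, β⟫_ℝ

end RootSystemData

section LieSetup

variable (V : Type*) [NormedAddCommGroup V] [InnerProductSpace ℝ V]
  (L : Type*) [LieRing L] [LieAlgebra ℂ L] [Module.Finite ℂ L]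

/-- A triangular decomposition of a finite-dimensional complex semisimple Lie algebra `L`,
with Cartan subalgebra `H`, root system `Δ` (realized in the real inner product space `V`,
the inner product being the one induced by the Killing form), chosen root vectors `e φ`,
and the projection `Φ : L → 𝔫₋` with kernel `𝔟 = 𝔥 ⊕ 𝔫`. -/
structure CascadeLieData extends RootSystemData V where
  /-- the root vectors `e_φ` -/
  e : V → L
  /-- the Cartan subalgebra `𝔥` -/
  H : LieSubalgebra ℂ L
  /-- the realization of `V` inside `𝔥*`: each `φ ∈ V` gives a functional on `𝔥` -/
  wt : V →ₗ[ℝ] (H →ₗ[ℂ] ℂ)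
  wt_inj : Function.Injective wt
  e_ne : ∀ φ ∈ Δ, e φ ≠ 0
  indep : LinearIndependent ℂ fun φ : Δ => e (φ : V)
  root_vec : ∀ x : H, ∀ φ ∈ Δ, ⁅(x : L), e φ⁆ = wt φ x • e φ
  bracket_add : ∀ φ ∈ Δ, ∀ ψ ∈ Δ, φ + ψ ∈ Δ →
    ∃ c : ℂ, c ≠ 0 ∧ ⁅e φ, e ψ⁆ = c • e (φ + ψ)
  bracket_zero : ∀ φ ∈ Δ, ∀ ψ ∈ Δ, φ + ψ ∉ Δ → φ + ψ ≠ 0 → ⁅e φ, e ψ⁆ = 0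
  bracket_opp : ∀ φ ∈ Δ, ⁅e φ, e (-φ)⁆ ∈ H
  span_eq_top : H.toSubmodule ⊔ Submodule.span ℂ (e '' Δ) = ⊤
  killing_pair : ∀ φ ∈ Δ, killingForm ℂ L (e φ) (e (-φ)) ≠ 0
  killing_orth : ∀ φ ∈ Δ, ∀ ψ ∈ Δ, φ + ψ ≠ 0 → killingForm ℂ L (e φ) (e ψ) = 0
  /-- the projection `Φ : 𝔤 → 𝔫₋` with kernel `𝔟` -/
  Φ : L →ₗ[ℂ] L
  Φ_neg : ∀ z ∈ Submodule.span ℂ (e '' (Neg.neg '' Pos)), Φ z = z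
  Φ_b : ∀ z ∈ H.toSubmodule ⊔ Submodule.span ℂ (e '' Pos), Φ z = 0

end LieSetup

namespace CascadeLieData

variable {V : Type*} [NormedAddCommGroup V] [InnerProductSpace ℝ V]
  {L : Type*} [LieRing L] [LieAlgebra ℂ L] [Module.Finite ℂ L]
  (C : CascadeLieData V L)

/-- The nilradical `𝔫 = ⊕_{φ∈Δ₊} 𝔤_φ`. -/
def nSub : Submodule ℂ L := Submodule.span ℂ (C.e '' C.Pos)

/-- The opposite nilradical `𝔫₋`. -/
def nMinus : Submodule ℂ L := Submodule.span ℂ (C.e '' (Neg.neg '' C.Pos))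

/-- The Borel subalgebra `𝔟 = 𝔥 ⊕ 𝔫` (as a subspace). -/
def bSub : Submodule ℂ L := C.H.toSubmodule ⊔ C.nSub

/-- `𝔯 = span{e_β : β ∈ ℬ}`. -/
def rSub : Submodule ℂ L := Submodule.span ℂ (C.e '' C.toRootSystemData.cascade)

/-- `𝔯₋ = span{e_{−β} : β ∈ ℬ}`. -/
def rMinus : Submodule ℂ L :=
  Submodule.span ℂ (C.e '' (Neg.neg '' C.toRootSystemData.cascade))

/-- `𝔯₋ˣ`: the elements of `𝔯₋` all of whose coefficients are nonzero. -/
def rMinusX : Set L :=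
  {z | ∃ a : V → ℂ, (∀ β ∈ C.toRootSystemData.cascade, a β ≠ 0) ∧
    z = ∑ᶠ β ∈ C.toRootSystemData.cascade, a β • C.e (-β)}

/-- `𝔰 = span{e_φ : φ ∈ Δ₊ \ ℬ}`. -/
def sSub : Submodule ℂ L :=
  Submodule.span ℂ (C.e '' (C.Pos \ C.toRootSystemData.cascade))

/-- `𝔰₋ = span{e_{−φ} : φ ∈ Δ₊ \ ℬ}`. -/
def sMinus : Submodule ℂ L :=
  Submodule.span ℂ (C.e '' (Neg.neg '' (C.Pos \ C.toRootSystemData.cascade)))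

/-- `𝔰(β) = span{e_φ : φ ∈ E(β), φ ≠ β}`. -/
def sBeta (β : V) : Submodule ℂ L :=
  Submodule.span ℂ (C.e '' (C.toRootSystemData.E β \ {β}))

/-- `𝔰(−β) = span{e_{−φ} : φ ∈ E(β), φ ≠ β}`. -/
def sBetaMinus (β : V) : Submodule ℂ L :=
  Submodule.span ℂ (C.e '' (Neg.neg '' (C.toRootSystemData.E β \ {β})))

/-- `𝔢(β) = span{e_φ : φ ∈ E(β)}`. -/
def eSub (β : V) : Submodule ℂ L := Submodule.span ℂ (C.e '' C.toRootSystemData.E β)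

/-- `𝔤(β)`: the Lie subalgebra generated by the root spaces `𝔤_{±α}`, `α ∈ Π(β)`. -/
def gSub (β : V) : LieSubalgebra ℂ L :=
  LieSubalgebra.lieSpan ℂ L
    (C.e '' C.toRootSystemData.support β ∪ C.e '' (Neg.neg '' C.toRootSystemData.support β))

end CascadeLieData

namespace RootSystemData

variable {V : Type*} [NormedAddCommGroup V] [InnerProductSpace ℝ V] {R : RootSystemData V}

theorem ne_zero_of_mem {α : V} (hα : α ∈ R.Δ) : α ≠ 0 := fun h => R.zero_not_mem (h ▸ hα)

theorem inner_self_pos_of_mem {α : V} (hα : α ∈ R.Δ) : 0 < ⟪α, α⟫_ℝ :=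
  real_inner_self_pos.2 (ne_zero_of_mem hα)

theorem sub_zsmul_mem {α β : V} (hα : α ∈ R.Δ) (hβ : β ∈ R.Δ) {n : ℤ}
    (hn : 2 * ⟪α, β⟫_ℝ = n * ⟪β, β⟫_ℝ) : α - (n : ℝ) • β ∈ R.Δ := by
  have h := R.reflect_mem α hα β hβ
  rwa [hn, mul_div_assoc, div_self (inner_self_pos_of_mem hβ).ne', mul_one] at h

/-- The difference of two distinct roots at an acute angle is a root. -/
theorem sub_mem_of_inner_pos {α β : V} (hα : α ∈ R.Δ) (hβ : β ∈ R.Δ) (hne : α ≠ β)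
    (h : 0 < ⟪α, β⟫_ℝ) : α - β ∈ R.Δ := by
  obtain ⟨n, hn⟩ := R.crystal α hα β hβ
  obtain ⟨m, hm⟩ := R.crystal β hβ α hα
  have hsymm := real_inner_comm α β
  have ha := inner_self_pos_of_mem hα
  have hb := inner_self_pos_of_mem hβ
  have hn0 : 0 < n := by
    have : (0 : ℝ) < n := by by_contra! hc; nlinarith
    exact_mod_cast this
  have hm0 : 0 < m := by
    have : (0 : ℝ) < m := by by_contra! hc; nlinarith
    exact_mod_cast this
  by_cases hn1 : n = 1
  · simpa [hn1] using sub_zsmul_mem hα hβ hn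
  by_cases hm1 : m = 1
  · have h2 := R.neg_mem _ (sub_zsmul_mem hβ hα hm)
    simpa [hm1] using h2
  have hn2 : (2 : ℝ) ≤ n := by exact_mod_cast (by omega : 2 ≤ n)
  have hm2 : (2 : ℝ) ≤ m := by exact_mod_cast (by omega : 2 ≤ m)
  have hd : ⟪α - β, α - β⟫_ℝ ≤ 0 := by
    rw [real_inner_sub_sub_self]; nlinarith
  exact absurd (sub_eq_zero.1 (real_inner_self_nonpos.1 hd)) hne

theorem add_mem_of_inner_neg {α β : V} (hα : α ∈ R.Δ) (hβ : β ∈ R.Δ) (hne : α + β ≠ 0)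
    (h : ⟪α, β⟫_ℝ < 0) : α + β ∈ R.Δ := by
  have := sub_mem_of_inner_pos hα (R.neg_mem β hβ) (fun h => hne (by simp [h]))
    (by simpa [inner_neg_right] using h)
  simpa using this

theorem pos_or_neg_pos {α : V} (hα : α ∈ R.Δ) : α ∈ R.Pos ∨ -α ∈ R.Pos := R.mem_or_neg α hα

theorem add_ne_zero_of_pos {α β : V} (hα : α ∈ R.Pos) (hβ : β ∈ R.Pos) : α + β ≠ 0 := fun h =>
  R.not_neg_mem α hα (by rwa [neg_eq_of_add_eq_zero_right h])

theorem multiset_eq_zero_of_sum_eq_zero (s : Multiset V) (hs : ∀ x ∈ s, x ∈ R.Pos)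
    (h0 : s.sum = 0) : s = 0 := by
  induction hn : s.card generalizing s with
  | zero => exact Multiset.card_eq_zero.1 hn
  | succ n ih =>
    obtain ⟨a, has⟩ := Multiset.card_pos_iff_exists_mem.1 (by omega : 0 < s.card)
    obtain ⟨t, rfl⟩ := Multiset.exists_cons_of_mem has
    exfalso
    have ha := hs a (by simp)
    have ht : ∃ x ∈ t, ⟪a, x⟫_ℝ < 0 := by
      by_contra! hc
      have h1 : 0 ≤ ⟪a, t.sum⟫_ℝ := by
        clear hn h0 hs has
        induction t using Multiset.induction_on with
        | empty => simp
        | cons b u ihu =>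
          rw [Multiset.sum_cons, inner_add_right]
          exact add_nonneg (hc b (by simp)) (ihu fun x hx => hc x (by simp [hx]))
      have h2 : ⟪a, (a ::ₘ t).sum⟫_ℝ = 0 := by rw [h0, inner_zero_right]
      rw [Multiset.sum_cons, inner_add_right] at h2
      have := inner_self_pos_of_mem (R.pos_subset ha)
      linarith
    obtain ⟨x, hx, hax⟩ := ht
    obtain ⟨u, rfl⟩ := Multiset.exists_cons_of_mem hx
    have hxP := hs x (by simp)
    have hmem : a + x ∈ R.Pos := R.pos_add a ha x hxP
      (add_mem_of_inner_neg (R.pos_subset ha) (R.pos_subset hxP) (add_ne_zero_of_pos ha hxP) hax)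
    have := ih ((a + x) ::ₘ u)
      (by
        intro y hy
        rcases Multiset.mem_cons.1 hy with rfl | hy
        · exact hmem
        · exact hs y (by simp [hy]))
      (by simpa [add_assoc] using h0) (by simpa using hn)
    simp at this

theorem neg_notMem_closure_pos {φ : V} (hφ : φ ∈ R.Pos) : -φ ∉ AddSubmonoid.closure R.Pos := by
  intro h
  obtain ⟨s, hs, hsum⟩ := AddSubmonoid.exists_multiset_of_mem_closure h
  have := multiset_eq_zero_of_sum_eq_zero (R := R) (φ ::ₘ s)
    (by simpa using ⟨hφ, hs⟩) (by simp [hsum])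
  simp at this

theorem sub_simple_pos {α β : V} (hα : α ∈ R.Simple) (hβ : β ∈ R.Pos)
    (h : β - α ∈ R.Δ) : β - α ∈ R.Pos := by
  refine (pos_or_neg_pos h).resolve_right fun hn => hα.2 ⟨β, hβ, _, hn, by abel⟩

/-- A simple reflection preserves the set of positive roots other than the simple root. -/
theorem sub_zsmul_simple_pos {α β : V} (hα : α ∈ R.Simple) (hβ : β ∈ R.Pos) (hne : β ≠ α)
    {n : ℤ} (hn : 2 * ⟪β, α⟫_ℝ = n * ⟪α, α⟫_ℝ) : β - (n : ℝ) • α ∈ R.Pos := by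
  have hαΔ := R.pos_subset hα.1
  rcases le_or_gt 0 n with h0 | h0
  · lift n to ℕ using h0
    induction n using Nat.strong_induction_on generalizing β with
    | _ n ih =>
      have hmem := sub_zsmul_mem (R.pos_subset hβ) hαΔ hn
      match n, ih, hn, hmem with
      | 0, _, _, _ => simpa using hβ
      | 1, _, _, hmem =>
        have := sub_simple_pos hα hβ (by simpa using hmem)
        simpa using this
      | k + 2, ih, hn, hmem =>
        have ha := inner_self_pos_of_mem hαΔ
        have hin : 0 < ⟪β, α⟫_ℝ := by
          push_cast at hn
          have : (0 : ℝ) ≤ k := Nat.cast_nonneg k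
          nlinarith
        have hsub : β - α ∈ R.Pos :=
          sub_simple_pos hα hβ (sub_mem_of_inner_pos (R.pos_subset hβ) hαΔ hne hin)
        have hne' : β - α ≠ α := fun h => by
          have h2 : (2 : ℝ) • α ∈ R.Δ := by
            rw [two_smul, ← sub_eq_iff_eq_add.1 h]; exact R.pos_subset hβ
          rcases R.reduced α hαΔ 2 h2 with h | h <;> norm_num at h
        have key := ih k (by omega) hsub hne' (by
          rw [inner_sub_left]; push_cast at hn ⊢; linarith)
        have heq : β - (((k + 2 : ℕ) : ℤ) : ℝ) • α = (β - α - (((k : ℕ) : ℤ) : ℝ) • α) - α := by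
          push_cast; module
        rw [heq] at hmem ⊢
        exact sub_simple_pos hα key hmem
  · refine (pos_or_neg_pos (sub_zsmul_mem (R.pos_subset hβ) hαΔ hn)).resolve_right fun hneg => ?_
    refine neg_notMem_closure_pos hneg ?_
    rw [neg_neg]
    obtain ⟨k, rfl⟩ : ∃ k : ℕ, n = -(k : ℤ) := ⟨n.natAbs, by omega⟩
    have : β - ((-(k : ℤ) : ℤ) : ℝ) • α = β + k • α := by
      push_cast; rw [neg_smul, sub_neg_eq_add, Nat.cast_smul_eq_nsmul]
    rw [this]
    exact add_mem (AddSubmonoid.subset_closure hβ)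
      (nsmul_mem (AddSubmonoid.subset_closure hα.1) k)

theorem finite_pos (R : RootSystemData V) : R.Pos.Finite := R.finite.subset R.pos_subset

open Classical in
theorem inner_sum_pos_of_simple {α : V} (hα : α ∈ R.Simple) :
    0 < ⟪∑ φ ∈ R.finite_pos.toFinset, φ, α⟫_ℝ := by
  have hαΔ := R.pos_subset hα.1
  have ha := inner_self_pos_of_mem hαΔ
  rw [sum_inner, ← Finset.add_sum_erase _ _ (a := α) (by simpa using hα.1)]
  suffices h : ∑ φ ∈ R.finite_pos.toFinset.erase α, ⟪φ, α⟫_ℝ = 0 by rw [h]; simpa using ha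
  have hrefl : ∀ φ : V, ⟪reflectRoot α φ, α⟫_ℝ = -⟪φ, α⟫_ℝ := fun φ => by
    rw [reflectRoot, inner_sub_left, real_inner_smul_left, div_mul_cancel₀ _ ha.ne']; ring
  refine Finset.sum_involution (fun φ _ => reflectRoot α φ) ?_ ?_ ?_ ?_
  · intro φ _; rw [hrefl]; ring
  · intro φ _ h0 heq
    have := hrefl φ
    rw [heq] at this
    exact h0 (by linarith)
  · intro φ hφ
    simp only [Finset.mem_erase, Set.Finite.mem_toFinset] at hφ ⊢
    obtain ⟨n, hn⟩ := R.crystal φ (R.pos_subset hφ.2) α hαΔ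
    have h := sub_zsmul_simple_pos hα hφ.2 hφ.1 hn
    have heq : reflectRoot α φ = φ - (n : ℝ) • α := by
      rw [reflectRoot, hn, mul_div_assoc, div_self ha.ne', mul_one]
    refine ⟨fun hc => ?_, heq ▸ h⟩
    have h1 := hrefl φ
    rw [hc] at h1
    have h2 : φ = (1 + (n : ℝ)) • α := by
      rw [heq] at hc; rw [add_smul, one_smul]; exact sub_eq_iff_eq_add.1 hc
    rcases R.reduced α hαΔ (1 + n) (h2 ▸ R.pos_subset hφ.2) with h3 | h3
    · exact hφ.1 (by rw [h2, h3, one_smul])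
    · rw [h3, neg_smul, one_smul] at h2
      exact R.not_neg_mem α hα.1 (h2 ▸ hφ.2)
  · intro φ _
    have := hrefl φ
    rw [reflectRoot, this, reflectRoot]
    module

/-- Roots sets stable under taking roots in the span, and under splitting into positive roots:
the parabolic subsystems generated by simple roots. -/
structure Facial (R : RootSystemData V) (F : Set V) : Prop where
  subset : F ⊆ R.Δ
  mem_of_mem_span : ∀ θ ∈ R.Δ, θ ∈ Submodule.span ℝ F → θ ∈ F
  split : ∀ φ ∈ R.Pos, ∀ ψ ∈ R.Pos, φ + ψ ∈ F → φ ∈ F ∧ ψ ∈ F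

theorem facial_Δ (R : RootSystemData V) : R.Facial R.Δ where
  subset := subset_rfl
  mem_of_mem_span _ h _ := h
  split _ hφ _ hψ _ := ⟨R.pos_subset hφ, R.pos_subset hψ⟩

/-- Induction on positive roots of a facial set, built up from simple ones. -/
theorem Facial.pos_induction {F : Set V} (hF : R.Facial F) {p : V → Prop}
    (simple : ∀ α ∈ R.Simple, α ∈ F → p α)
    (add : ∀ φ ∈ R.Pos, ∀ ψ ∈ R.Pos, φ ∈ F → ψ ∈ F → φ + ψ ∈ F → p φ → p ψ → p (φ + ψ))
    {φ : V} (hφ : φ ∈ R.Pos) (hφF : φ ∈ F) : p φ := by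
  let S : V → Set V := fun φ => {ψ ∈ R.Pos | φ - ψ ∈ AddSubmonoid.closure R.Pos}
  have hfin : ∀ φ, (S φ).Finite := fun φ => R.finite_pos.subset fun _ h => h.1
  have hlt : ∀ β ∈ R.Pos, ∀ γ ∈ R.Pos, β + γ ∈ R.Pos → (S β).ncard < (S (β + γ)).ncard := by
    intro β hβ γ hγ hmem
    refine Set.ncard_lt_ncard ⟨fun ψ hψ => ⟨hψ.1, ?_⟩, fun hsub => ?_⟩ (hfin _)
    · rw [add_sub_right_comm]
      exact add_mem hψ.2 (AddSubmonoid.subset_closure hγ)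
    · have := (hsub (show β + γ ∈ S (β + γ) from ⟨hmem, by simp⟩)).2
      rw [sub_add_cancel_left] at this
      exact neg_notMem_closure_pos hγ this
  induction hn : (S φ).ncard using Nat.strong_induction_on generalizing φ with
  | _ n ih =>
    by_cases hs : φ ∈ R.Simple
    · exact simple φ hs hφF
    · have : ∃ β ∈ R.Pos, ∃ γ ∈ R.Pos, φ = β + γ := by
        by_contra hc; exact hs ⟨hφ, hc⟩
      obtain ⟨β, hβ, γ, hγ, rfl⟩ := this
      obtain ⟨h1, h2⟩ := hF.split β hβ γ hγ hφF
      refine add β hβ γ hγ h1 h2 hφF (ih _ (hn ▸ hlt β hβ γ hγ hφ) hβ h1 rfl)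
        (ih _ ?_ hγ h2 rfl)
      rw [← hn, add_comm]
      exact hlt γ hγ β hβ (add_comm β γ ▸ hφ)

theorem Facial.mem_closure_simple {F : Set V} (hF : R.Facial F) {φ : V} (hφ : φ ∈ R.Pos)
    (hφF : φ ∈ F) : φ ∈ AddSubmonoid.closure (R.Simple ∩ F) :=
  hF.pos_induction (fun _ hα hαF => AddSubmonoid.subset_closure (show _ ∈ R.Simple ∩ F from ⟨hα, hαF⟩))
    (fun _ _ _ _ _ _ _ h1 h2 => add_mem h1 h2) hφ hφF

theorem closure_pos_eq (R : RootSystemData V) :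
    AddSubmonoid.closure R.Pos = AddSubmonoid.closure R.Simple := by
  refine le_antisymm ((AddSubmonoid.closure_le).2 fun φ hφ => ?_)
    (AddSubmonoid.closure_mono fun _ h => h.1)
  exact AddSubmonoid.closure_mono Set.inter_subset_left
    (R.facial_Δ.mem_closure_simple hφ (R.pos_subset hφ))

/-- The positive roots lie in an open half-space. -/
theorem exists_inner_pos (R : RootSystemData V) : ∃ h : V, ∀ φ ∈ R.Pos, 0 < ⟪h, φ⟫_ℝ := by
  refine ⟨∑ φ ∈ R.finite_pos.toFinset, φ, fun φ hφ => R.facial_Δ.pos_induction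
    (fun α hα _ => inner_sum_pos_of_simple hα) (fun φ _ ψ _ _ _ _ h1 h2 => ?_) hφ
    (R.pos_subset hφ)⟩
  rw [inner_add_right]
  exact add_pos h1 h2

theorem inner_nonneg_of_mem_closure {s : Set V} {h x : V} (hs : ∀ a ∈ s, 0 ≤ ⟪h, a⟫_ℝ)
    (hx : x ∈ AddSubmonoid.closure s) : 0 ≤ ⟪h, x⟫_ℝ := by
  induction hx using AddSubmonoid.closure_induction with
  | mem x hx => exact hs x hx
  | zero => simp
  | add x y _ _ h1 h2 => rw [inner_add_right]; exact add_nonneg h1 h2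

theorem inner_eq_zero_of_mem_span {s t : Set V} (h : ∀ a ∈ s, ∀ b ∈ t, ⟪a, b⟫_ℝ = 0) {x y : V}
    (hx : x ∈ Submodule.span ℝ s) (hy : y ∈ Submodule.span ℝ t) : ⟪x, y⟫_ℝ = 0 :=
  Submodule.isOrtho_iff_inner_eq.1 (Submodule.isOrtho_span.2 fun a ha b hb => h a ha b hb) x hx y hy

theorem mem_span_of_mem_closure {s : Set V} {x : V} (hx : x ∈ AddSubmonoid.closure s) :
    x ∈ Submodule.span ℝ s := Submodule.closure_subset_span hx

theorem inner_simple_nonpos {α β : V} (hα : α ∈ R.Simple) (hβ : β ∈ R.Simple) (hne : α ≠ β) :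
    ⟪α, β⟫_ℝ ≤ 0 := by
  by_contra! h
  rcases pos_or_neg_pos (sub_mem_of_inner_pos (R.pos_subset hα.1) (R.pos_subset hβ.1) hne h)
    with h | h
  · exact hα.2 ⟨β, hβ.1, _, h, by abel⟩
  · exact hβ.2 ⟨α, hα.1, _, h, by abel⟩

theorem linearIndepOn_simple (R : RootSystemData V) : LinearIndepOn ℝ id R.Simple := by
  obtain ⟨h, hh⟩ := R.exists_inner_pos
  refine LinearMap.BilinForm.linearIndependent_of_pairwise_le_zero (innerₗ V) ?_
    (innerₗ V h) _ (fun i => hh _ i.2.1) fun i j hij => ?_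
  · intro x hx
    exact real_inner_self_pos.2 hx
  · exact inner_simple_nonpos i.2 j.2 fun h => hij (Subtype.ext h)

theorem simple_add_notMem_span {α x : V} (hα : α ∈ R.Simple)
    (hx : x ∈ AddSubmonoid.closure R.Simple) :
    α + x ∉ Submodule.span ℝ (R.Simple \ {α}) := by
  have hind := linearIndepOn_iff_notMem_span.1 R.linearIndepOn_simple α hα
  rw [Set.image_id, id] at hind
  have key : ∃ n : ℕ, x - (n : ℝ) • α ∈ Submodule.span ℝ (R.Simple \ {α}) := by
    induction hx using AddSubmonoid.closure_induction with
    | mem x hx =>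
      by_cases hxα : x = α
      · exact ⟨1, by simp [hxα]⟩
      · exact ⟨0, by
          simpa using Submodule.subset_span (show x ∈ R.Simple \ {α} from ⟨hx, hxα⟩)⟩
    | zero => exact ⟨0, by simp⟩
    | add x y _ _ h1 h2 =>
      obtain ⟨n, hn⟩ := h1
      obtain ⟨m, hm⟩ := h2
      refine ⟨n + m, ?_⟩
      convert add_mem hn hm using 1
      push_cast; module
  obtain ⟨n, hn⟩ := key
  intro hmem
  have h1 : (1 + (n : ℝ)) • α ∈ Submodule.span ℝ (R.Simple \ {α}) := by
    convert sub_mem hmem hn using 1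
    module
  exact hind ((Submodule.smul_mem_iff _ (by positivity)).1 h1)

theorem nonnegComb_iff {x : V} : R.NonnegComb x ↔ x ∈ AddSubmonoid.closure R.Pos := by
  classical
  constructor
  · rintro ⟨c, hc, rfl⟩
    refine sum_mem fun α hα => ?_
    beta_reduce
    rw [Nat.cast_smul_eq_nsmul]
    exact nsmul_mem (AddSubmonoid.subset_closure (hc hα)) _
  · intro hx
    induction hx using AddSubmonoid.closure_induction with
    | mem x hx =>
      refine ⟨Finsupp.single x 1, ?_, by simp⟩
      exact (Finset.coe_subset.2 Finsupp.support_single_subset).trans (by simpa using hx)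
    | zero => exact ⟨0, by simp, by simp⟩
    | add x y _ _ h1 h2 =>
      obtain ⟨c, hc, rfl⟩ := h1
      obtain ⟨d, hd, rfl⟩ := h2
      refine ⟨c + d, ?_, ?_⟩
      · refine (Finset.coe_subset.2 Finsupp.support_add).trans ?_
        rw [Finset.coe_union]
        exact Set.union_subset hc hd
      · rw [Finsupp.sum_add_index' (by simp) (by simp [add_smul])]

theorem Facial.neg_mem {F : Set V} (hF : R.Facial F) {φ : V} (h : φ ∈ F) : -φ ∈ F :=
  hF.mem_of_mem_span _ (R.neg_mem _ (hF.subset h)) (Submodule.neg_mem _ (Submodule.subset_span h))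

theorem Facial.add_mem_of_root {F : Set V} (hF : R.Facial F) {φ ψ : V} (h1 : φ ∈ F) (h2 : ψ ∈ F)
    (h : φ + ψ ∈ R.Δ) : φ + ψ ∈ F :=
  hF.mem_of_mem_span _ h (Submodule.add_mem _ (Submodule.subset_span h1) (Submodule.subset_span h2))

theorem Facial.sub_mem_of_root {F : Set V} (hF : R.Facial F) {φ ψ : V} (h1 : φ ∈ F) (h2 : ψ ∈ F)
    (h : φ - ψ ∈ R.Δ) : φ - ψ ∈ F := by
  rw [sub_eq_add_neg] at h ⊢
  exact hF.add_mem_of_root h1 (hF.neg_mem h2) h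

/-- The simple roots lying below `β`. -/
def simpleBelow (R : RootSystemData V) (β : V) : Set V :=
  {α ∈ R.Simple | β - α ∈ AddSubmonoid.closure R.Pos}

theorem Facial.simpleBelow_subset {F : Set V} (hF : R.Facial F) {β : V} (hβ : β ∈ R.Pos)
    (hβF : β ∈ F) : R.simpleBelow β ⊆ F := by
  rintro α ⟨hα, hle⟩
  by_contra hαF
  rw [closure_pos_eq] at hle
  refine simple_add_notMem_span hα hle ?_
  rw [add_sub_cancel]
  refine Submodule.span_mono ?_ (mem_span_of_mem_closure (hF.mem_closure_simple hβ hβF))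
  rintro γ ⟨h1, h2⟩
  exact ⟨h1, fun h => hαF (h ▸ h2)⟩

theorem mem_closure_simpleBelow {β x : V} (hx : x ∈ AddSubmonoid.closure R.Pos)
    (hle : β - x ∈ AddSubmonoid.closure R.Pos) :
    x ∈ AddSubmonoid.closure (R.simpleBelow β) := by
  rw [closure_pos_eq] at hx
  obtain ⟨s, hs, rfl⟩ := AddSubmonoid.exists_multiset_of_mem_closure hx
  refine AddSubmonoid.multiset_sum_mem _ _ fun a ha => AddSubmonoid.subset_closure ⟨hs a ha, ?_⟩
  obtain ⟨t, rfl⟩ := Multiset.exists_cons_of_mem ha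
  have ht : t.sum ∈ AddSubmonoid.closure R.Pos :=
    AddSubmonoid.multiset_sum_mem _ _ fun b hb =>
      AddSubmonoid.subset_closure (hs b (by simp [hb])).1
  convert add_mem hle ht using 1
  rw [Multiset.sum_cons]; abel

/-- `β` is a positive root of `F` which is maximal in `F`. -/
structure IsMaximalIn (R : RootSystemData V) (F : Set V) (β : V) : Prop where
  pos : β ∈ R.Pos
  mem : β ∈ F
  add_notMem : ∀ φ ∈ R.Pos, β + φ ∉ F

theorem Facial.exists_isMaximalIn {F : Set V} (hF : R.Facial F) {ψ : V} (hψ : ψ ∈ R.Pos)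
    (hψF : ψ ∈ F) : ∃ β, R.IsMaximalIn F β ∧ β - ψ ∈ AddSubmonoid.closure R.Pos := by
  obtain ⟨h, hh⟩ := R.exists_inner_pos
  obtain ⟨β, ⟨h1, h2, h3⟩, hmax⟩ := Set.exists_max_image
    {β ∈ R.Pos | β ∈ F ∧ β - ψ ∈ AddSubmonoid.closure R.Pos} (fun β => ⟪h, β⟫_ℝ)
    (R.finite_pos.subset fun _ h => h.1) ⟨ψ, hψ, hψF, by simp⟩
  refine ⟨β, ⟨h1, h2, fun φ hφ hmem => ?_⟩, h3⟩
  have := hmax (β + φ) ⟨R.pos_add _ h1 _ hφ (hF.subset hmem), hmem, by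
    rw [add_sub_right_comm]; exact add_mem h3 (AddSubmonoid.subset_closure hφ)⟩
  simp only [inner_add_right] at this
  linarith [hh φ hφ]

theorem IsMaximalIn.inner_nonneg {F : Set V} (hF : R.Facial F) {β φ : V}
    (hβ : R.IsMaximalIn F β) (hφ : φ ∈ R.Pos) (hφF : φ ∈ F) : 0 ≤ ⟪β, φ⟫_ℝ := by
  by_contra! h
  exact hβ.add_notMem φ hφ (hF.add_mem_of_root hβ.mem hφF
    (add_mem_of_inner_neg (R.pos_subset hβ.pos) (R.pos_subset hφ)
      (add_ne_zero_of_pos hβ.pos hφ) h))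

theorem Facial.sub_notMem_of_orthogonal {F S T : Set V} (hF : R.Facial F) (hT : T ⊆ R.Pos)
    (hcover : R.Simple ∩ F ⊆ S ∪ T) (hST : ∀ a ∈ S, ∀ b ∈ T, ⟪a, b⟫_ℝ = 0) {φ ψ : V}
    (hφ : φ ∈ AddSubmonoid.closure S) (hψ : ψ ∈ AddSubmonoid.closure T) (hψP : ψ ∈ R.Pos)
    (hP : φ - ψ ∈ R.Pos) : φ - ψ ∉ F := by
  intro hmem
  have h := AddSubmonoid.closure_mono hcover (hF.mem_closure_simple hP hmem)
  rw [AddSubmonoid.closure_union, AddSubmonoid.mem_sup] at h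
  obtain ⟨s, hs, t, ht, hst⟩ := h
  have heq : φ - s = ψ + t := by
    rw [eq_add_of_sub_eq hst.symm]; abel
  have h0 : ⟪φ - s, ψ + t⟫_ℝ = 0 := inner_eq_zero_of_mem_span hST
    (Submodule.sub_mem _ (mem_span_of_mem_closure hφ) (mem_span_of_mem_closure hs))
    (Submodule.add_mem _ (mem_span_of_mem_closure hψ) (mem_span_of_mem_closure ht))
  rw [heq, inner_self_eq_zero] at h0
  refine neg_notMem_closure_pos hψP ?_
  rw [neg_eq_of_add_eq_zero_right h0]
  exact AddSubmonoid.closure_mono hT ht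

theorem sub_mem_of_orthogonal {φ ψ : V} (hψ : ψ ∈ R.Δ) (h : φ + ψ ∈ R.Δ)
    (h0 : ⟪φ, ψ⟫_ℝ = 0) : φ - ψ ∈ R.Δ := by
  have := sub_zsmul_mem h hψ (n := 2) (by rw [inner_add_left, h0]; push_cast; ring)
  convert this using 1
  push_cast; module

theorem Facial.mem_closure_or_of_orthogonal {F S T : Set V} (hF : R.Facial F) (hS : S ⊆ R.Pos)
    (hT : T ⊆ R.Pos) (hcover : R.Simple ∩ F ⊆ S ∪ T) (hST : ∀ a ∈ S, ∀ b ∈ T, ⟪a, b⟫_ℝ = 0)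
    {φ : V} (hφ : φ ∈ R.Pos) (hφF : φ ∈ F) :
    φ ∈ AddSubmonoid.closure S ∨ φ ∈ AddSubmonoid.closure T := by
  have hTS : ∀ b ∈ T, ∀ a ∈ S, ⟪b, a⟫_ℝ = 0 := fun b hb a ha => by
    rw [real_inner_comm]; exact hST a ha b hb
  have key : ∀ φ ∈ R.Pos, ∀ ψ ∈ R.Pos, φ ∈ F → ψ ∈ F → φ + ψ ∈ F →
      φ ∈ AddSubmonoid.closure S → ψ ∉ AddSubmonoid.closure T := by
    intro φ hφ ψ hψ hφF hψF hadd h1 h2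
    have h0 : ⟪φ, ψ⟫_ℝ = 0 := inner_eq_zero_of_mem_span hST
      (mem_span_of_mem_closure h1) (mem_span_of_mem_closure h2)
    have hsub := sub_mem_of_orthogonal (hF.subset hψF) (hF.subset hadd) h0
    have hsubF := hF.sub_mem_of_root hφF hψF hsub
    rcases pos_or_neg_pos hsub with h | h
    · exact hF.sub_notMem_of_orthogonal hT hcover hST h1 h2 hψ h hsubF
    · have h3 := hF.neg_mem hsubF
      rw [neg_sub] at h h3
      exact hF.sub_notMem_of_orthogonal hS (Set.union_comm S T ▸ hcover) hTS h2 h1 hφ h h3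
  refine hF.pos_induction
    (p := fun φ => φ ∈ AddSubmonoid.closure S ∨ φ ∈ AddSubmonoid.closure T)
    (fun α hα hαF => ?_) (fun φ hφ ψ hψ hφF hψF hadd h1 h2 => ?_) hφ hφF
  · exact (hcover ⟨hα, hαF⟩).imp (fun h => AddSubmonoid.subset_closure h)
      fun h => AddSubmonoid.subset_closure h
  · rcases h1 with h1 | h1 <;> rcases h2 with h2 | h2
    · exact Or.inl (add_mem h1 h2)
    · exact absurd h2 (key φ hφ ψ hψ hφF hψF hadd h1)
    · exact absurd h1 (key ψ hψ φ hφ hψF hφF (add_comm φ ψ ▸ hadd) h2)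
    · exact Or.inr (add_mem h1 h2)

/-- In an irreducible facial set every simple root lies below any maximal root. -/
theorem IsMaximalIn.simple_subset {F : Set V} (hF : R.Facial F) (hirr : IsIrred F) {β : V}
    (hβ : R.IsMaximalIn F β) : R.Simple ∩ F ⊆ R.simpleBelow β := by
  set S := R.simpleBelow β with hS
  set T := (R.Simple ∩ F) \ S with hT
  have hSP : S ⊆ R.Pos := fun a ha => ha.1.1
  have hTP : T ⊆ R.Pos := fun a ha => ha.1.1.1
  have hSF : S ⊆ F := hF.simpleBelow_subset hβ.pos hβ.mem
  have hST : ∀ a ∈ S, ∀ b ∈ T, ⟪a, b⟫_ℝ = 0 := by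
    intro a ha b hb
    have hobtuse : ∀ c ∈ S, 0 ≤ ⟪-b, c⟫_ℝ := fun c hc => by
      rw [inner_neg_left, neg_nonneg]
      exact inner_simple_nonpos hb.1.1 hc.1 fun h => hb.2 (h ▸ hc)
    have h1 := inner_nonneg_of_mem_closure hobtuse
      (mem_closure_simpleBelow (x := β - a) ha.2
        (by rw [sub_sub_cancel]; exact AddSubmonoid.subset_closure (hSP ha)))
    have h2 := hβ.inner_nonneg hF (hTP hb) hb.1.2
    have h3 := hobtuse a ha
    rw [inner_neg_left, inner_sub_right] at h1
    rw [inner_neg_left] at h3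
    rw [real_inner_comm] at h2 ⊢
    linarith
  have hcover : R.Simple ∩ F ⊆ S ∪ T := fun a ha => by
    by_cases h : a ∈ S
    · exact Or.inl h
    · exact Or.inr ⟨ha, h⟩
  intro α hα
  by_contra hαS
  have horth : ∀ x ∈ Submodule.span ℝ S, ∀ y ∈ Submodule.span ℝ T, ⟪x, y⟫_ℝ = 0 :=
    fun x hx y hy => inner_eq_zero_of_mem_span hST hx hy
  refine hirr.2 ⟨F ∩ Submodule.span ℝ S, F ∩ Submodule.span ℝ T, ?_, ?_, ?_, ?_, ?_⟩
  · refine Set.Subset.antisymm (Set.union_subset Set.inter_subset_left Set.inter_subset_left)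
      fun φ hφ => ?_
    rcases pos_or_neg_pos (hF.subset hφ) with h | h
    · exact (hF.mem_closure_or_of_orthogonal hSP hTP hcover hST h hφ).imp
        (fun h => ⟨hφ, mem_span_of_mem_closure h⟩) (fun h => ⟨hφ, mem_span_of_mem_closure h⟩)
    · exact (hF.mem_closure_or_of_orthogonal hSP hTP hcover hST h (hF.neg_mem hφ)).imp
        (fun h => ⟨hφ, (Submodule.neg_mem_iff _).1 (mem_span_of_mem_closure h)⟩)
        (fun h => ⟨hφ, (Submodule.neg_mem_iff _).1 (mem_span_of_mem_closure h)⟩)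
  · refine Set.eq_empty_of_forall_notMem fun x hx => ?_
    exact ne_zero_of_mem (hF.subset hx.1.1) (inner_self_eq_zero.1 (horth x hx.1.2 x hx.2.2))
  · exact ⟨β, hβ.mem, mem_span_of_mem_closure
      (mem_closure_simpleBelow (AddSubmonoid.subset_closure hβ.pos) (by simp))⟩
  · exact ⟨α, hα.2, Submodule.subset_span ⟨hα, hαS⟩⟩
  · exact fun a ha b hb => horth a ha.2 b hb.2

theorem IsMaximalIn.unique {F : Set V} (hF : R.Facial F) (hirr : IsIrred F) {β γ : V}
    (hβ : R.IsMaximalIn F β) (hγ : R.IsMaximalIn F γ) : β = γ := by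
  by_contra hne
  have hβF := hβ.simple_subset hF hirr
  have hγF := hγ.simple_subset hF hirr
  have hnonneg : ∀ a ∈ R.Simple ∩ F, 0 ≤ ⟪β, a⟫_ℝ := fun a ha => hβ.inner_nonneg hF ha.1.1 ha.2
  obtain ⟨α, hα, hpos⟩ : ∃ α ∈ R.Simple ∩ F, 0 < ⟪β, α⟫_ℝ := by
    by_contra! hc
    have := inner_nonneg_of_mem_closure (h := -β)
      (fun a ha => by rw [inner_neg_left, neg_nonneg]; exact hc a ha)
      (hF.mem_closure_simple hβ.pos hβ.mem)
    rw [inner_neg_left] at this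
    linarith [inner_self_pos_of_mem (hF.subset hβ.mem)]
  have hle := (hγF hα).2
  have h1 := inner_nonneg_of_mem_closure
    (fun a ha => hnonneg a ⟨ha.1, hF.simpleBelow_subset hγ.pos hγ.mem ha⟩)
    (mem_closure_simpleBelow hle (by
      rw [sub_sub_cancel]; exact AddSubmonoid.subset_closure hα.1.1))
  rw [inner_sub_right] at h1
  rcases pos_or_neg_pos (sub_mem_of_inner_pos (hF.subset hβ.mem) (hF.subset hγ.mem) hne
    (by linarith)) with h | h
  · exact hγ.add_notMem _ h (by rw [add_sub_cancel]; exact hβ.mem)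
  · exact hβ.add_notMem _ h (by rw [neg_sub, add_sub_cancel]; exact hγ.mem)

theorem Facial.exists_isHighest {F : Set V} (hF : R.Facial F) (hirr : IsIrred F) :
    ∃ β, R.IsHighest F β := by
  obtain ⟨φ, hφ, hφF⟩ : ∃ φ ∈ R.Pos, φ ∈ F := by
    obtain ⟨φ, hφ⟩ := hirr.1
    rcases pos_or_neg_pos (hF.subset hφ) with h | h
    · exact ⟨φ, h, hφ⟩
    · exact ⟨-φ, h, hF.neg_mem hφ⟩
  obtain ⟨β, hβ, -⟩ := hF.exists_isMaximalIn hφ hφF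
  have hle : ∀ ψ ∈ R.Pos, ψ ∈ F → β - ψ ∈ AddSubmonoid.closure R.Pos := by
    intro ψ hψ hψF
    obtain ⟨γ, hγ, hγψ⟩ := hF.exists_isMaximalIn hψ hψF
    rwa [hβ.unique hF hirr hγ]
  refine ⟨β, hβ.mem, hβ.pos, fun ψ hψ => nonnegComb_iff.2 ?_⟩
  rcases pos_or_neg_pos (hF.subset hψ) with h | h
  · exact hle ψ h hψ
  · rw [sub_eq_add_neg]
    exact add_mem (AddSubmonoid.subset_closure hβ.pos) (AddSubmonoid.subset_closure h)

theorem IsHighest.isMaximalIn {F : Set V} {β : V} (hβ : R.IsHighest F β) :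
    R.IsMaximalIn F β where
  pos := hβ.2.1
  mem := hβ.1
  add_notMem φ hφ hmem := by
    have := nonnegComb_iff.1 (hβ.2.2 _ hmem)
    rw [sub_add_cancel_left] at this
    exact neg_notMem_closure_pos hφ this

theorem IsHighest.unique {F : Set V} {β γ : V} (hβ : R.IsHighest F β) (hγ : R.IsHighest F γ) :
    β = γ := by
  obtain ⟨s, hs, hs'⟩ :=
    AddSubmonoid.exists_multiset_of_mem_closure (nonnegComb_iff.1 (hβ.2.2 γ hγ.1))
  obtain ⟨t, ht, ht'⟩ :=
    AddSubmonoid.exists_multiset_of_mem_closure (nonnegComb_iff.1 (hγ.2.2 β hβ.1))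
  have h0 := multiset_eq_zero_of_sum_eq_zero (R := R) (s + t)
    (fun x hx => (Multiset.mem_add.1 hx).elim (hs x) (ht x))
    (by rw [Multiset.sum_add, hs', ht']; abel)
  rw [(add_eq_zero.1 h0).1, Multiset.sum_zero] at hs'
  exact sub_eq_zero.1 hs'.symm

/-- A facial set with highest root `β` is the root subsystem `Δ(β)`. -/
theorem IsHighest.sub_eq {F : Set V} (hF : R.Facial F) {β : V} (hβ : R.IsHighest F β) :
    R.sub β = F := by
  have hsupp : R.support β = R.Simple ∩ F := by
    refine Set.Subset.antisymm (fun α hα => ⟨hα.1, ?_⟩) fun α hα => ⟨hα.1, ?_⟩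
    · by_contra hαF
      refine hα.2 (Submodule.span_mono ?_
        (mem_span_of_mem_closure (hF.mem_closure_simple hβ.2.1 hβ.1)))
      rintro γ ⟨h1, h2⟩
      exact ⟨h1, fun h => hαF (h ▸ h2)⟩
    · have hle := nonnegComb_iff.1 (hβ.2.2 α hα.2)
      rw [closure_pos_eq] at hle
      simpa using simple_add_notMem_span hα.1 hle
  refine Set.Subset.antisymm (fun θ hθ => ?_) fun θ hθ => ⟨hF.subset hθ, ?_⟩
  · have h2 := hθ.2
    rw [hsupp] at h2
    exact hF.mem_of_mem_span θ hθ.1 (Submodule.span_mono Set.inter_subset_right h2)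
  · rw [hsupp]
    rcases pos_or_neg_pos (hF.subset hθ) with h | h
    · exact mem_span_of_mem_closure (hF.mem_closure_simple h hθ)
    · exact (Submodule.neg_mem_iff _).1
        (mem_span_of_mem_closure (hF.mem_closure_simple h (hF.neg_mem hθ)))

end RootSystemData

namespace RootSystemData

variable {V : Type*} [NormedAddCommGroup V] [InnerProductSpace ℝ V] {R : RootSystemData V}

theorem mem_of_isComponent_of_mem_span {F K : Set V} (hF : R.Facial F) (hK : IsComponent F K)
    {θ : V} (hθ : θ ∈ R.Δ) (hspan : θ ∈ Submodule.span ℝ K) : θ ∈ K := by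
  by_contra hθK
  have hθF := hF.mem_of_mem_span θ hθ (Submodule.span_mono hK.1 hspan)
  have h0 : ⟪θ, θ⟫_ℝ = 0 := inner_eq_zero_of_mem_span (t := {θ})
    (fun a ha b hb => hK.2.2 a ha b (by rw [hb]; exact ⟨hθF, hθK⟩)) hspan
    (Submodule.mem_span_singleton_self θ)
  exact (inner_self_pos_of_mem hθ).ne' h0

theorem Facial.isComponent {F K : Set V} (hF : R.Facial F) (hK : IsComponent F K) :
    R.Facial K where
  subset := hK.1.trans hF.subset
  mem_of_mem_span _ hθ h := mem_of_isComponent_of_mem_span hF hK hθ h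
  split φ hφ ψ hψ h := by
    obtain ⟨hφF, hψF⟩ := hF.split φ hφ ψ hψ (hK.1 h)
    have hone : ∀ φ ∈ R.Pos, ∀ ψ ∈ K, φ + ψ ∈ K → φ ∈ K := fun φ hφ ψ hψ h => by
      refine mem_of_isComponent_of_mem_span hF hK (R.pos_subset hφ) ?_
      simpa using Submodule.sub_mem _ (Submodule.subset_span h) (Submodule.subset_span hψ)
    by_cases hψK : ψ ∈ K
    · exact ⟨hone φ hφ ψ hψK h, hψK⟩
    by_cases hφK : φ ∈ K
    · exact ⟨hφK, hone ψ hψ φ hφK (add_comm φ ψ ▸ h)⟩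
    exfalso
    have h1 := hK.2.2 _ h φ ⟨hφF, hφK⟩
    have h2 := hK.2.2 _ h ψ ⟨hψF, hψK⟩
    have h3 := inner_self_pos_of_mem (hF.subset (hK.1 h))
    rw [inner_add_right, h1, h2, add_zero] at h3
    exact lt_irrefl _ h3

theorem Facial.orth {F : Set V} (hF : R.Facial F) {β : V} (hβ : R.IsHighest F β) :
    R.Facial (R.orth β) := by
  have hsub := hβ.sub_eq hF
  refine ⟨fun φ hφ => hφ.1.1, fun θ hθ hspan => ⟨?_, ?_⟩, fun φ hφ ψ hψ h => ?_⟩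
  · rw [hsub]
    exact hF.mem_of_mem_span θ hθ
      (Submodule.span_mono (fun φ hφ => hsub ▸ hφ.1) hspan)
  · exact inner_eq_zero_of_mem_span (t := {β}) (fun a ha b hb => by rw [hb]; exact ha.2) hspan
      (Submodule.mem_span_singleton_self β)
  · obtain ⟨hφF, hψF⟩ := hF.split φ hφ ψ hψ (hsub ▸ h.1)
    have h1 := hβ.isMaximalIn.inner_nonneg hF hφ hφF
    have h2 := hβ.isMaximalIn.inner_nonneg hF hψ hψF
    have h3 := h.2
    rw [real_inner_comm] at h1 h2
    rw [inner_add_left] at h3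
    exact ⟨⟨hsub ▸ hφF, by linarith⟩, ⟨hsub ▸ hψF, by linarith⟩⟩

theorem orth_subset {F : Set V} (hF : R.Facial F) {β : V} (hβ : R.IsHighest F β) :
    R.orth β ⊆ F := fun _ hφ => hβ.sub_eq hF ▸ hφ.1

end RootSystemData

theorem IsComponent.eq_of_mem {V : Type*} [NormedAddCommGroup V] [InnerProductSpace ℝ V]
    {S K K' : Set V} (hK : IsComponent S K) (hK' : IsComponent S K') {φ : V} (h : φ ∈ K)
    (h' : φ ∈ K') : K = K' := by
  have key : ∀ {K K' : Set V}, IsComponent S K → IsComponent S K' → φ ∈ K → φ ∈ K' → K ⊆ K' := by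
    intro K K' hK hK' h h' x hx
    by_contra hxK'
    exact hK.2.1.2 ⟨K ∩ K', K \ K', Set.inter_union_sdiff K K',
      Set.disjoint_iff_inter_eq_empty.1 (Set.disjoint_sdiff_right.mono_left Set.inter_subset_right),
      ⟨φ, h, h'⟩, ⟨x, hx, hxK'⟩, fun a ha b hb => hK'.2.2 a ha.2 b ⟨hK.1 hb.1, hb.2⟩⟩
  exact (key hK hK' h h').antisymm (key hK' hK h' h)

theorem Set.Finite.exists_isComponent {V : Type*} [NormedAddCommGroup V]
    [InnerProductSpace ℝ V] {S : Set V} (hS : S.Finite) {φ : V} (hφ : φ ∈ S) :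
    ∃ K, IsComponent S K ∧ φ ∈ K := by
  have hfin : {K : Set V | K ⊆ S ∧ φ ∈ K ∧ ∀ a ∈ K, ∀ b ∈ S \ K, ⟪a, b⟫_ℝ = 0}.Finite :=
    hS.finite_subsets.subset fun _ h => h.1
  obtain ⟨K, ⟨hKS, hφK, horth⟩, hmin⟩ := hfin.exists_minimal
    ⟨S, subset_rfl, hφ, fun _ _ b hb => absurd hb.1 hb.2⟩
  refine ⟨K, ⟨hKS, ⟨⟨φ, hφK⟩, ?_⟩, horth⟩, hφK⟩
  have key : ∀ A B : Set V, A ∪ B = K → A ∩ B = ∅ → B.Nonempty →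
      (∀ a ∈ A, ∀ b ∈ B, ⟪a, b⟫_ℝ = 0) → φ ∉ A := by
    rintro A B rfl hAB ⟨b, hb⟩ hortho hφA
    have hbA : b ∉ A := fun h => Set.eq_empty_iff_forall_notMem.1 hAB b ⟨h, hb⟩
    refine hbA (hmin (y := A) ⟨Set.subset_union_left.trans hKS, hφA, fun a ha c hc => ?_⟩
      Set.subset_union_left (Or.inr hb))
    by_cases hcB : c ∈ B
    · exact hortho a ha c hcB
    · exact horth a (Or.inl ha) c ⟨hc.1, fun h => h.elim hc.2 hcB⟩
  rintro ⟨A, B, hU, hI, hA, hB, hortho⟩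
  rcases (hU ▸ hφK : φ ∈ A ∪ B) with h | h
  · exact key A B hU hI hB hortho h
  · exact key B A (Set.union_comm A B ▸ hU) (Set.inter_comm A B ▸ hI) hA
      (fun b hb a ha => by rw [real_inner_comm]; exact hortho a ha b hb) h

namespace RootSystemData

variable {V : Type*} [NormedAddCommGroup V] [InnerProductSpace ℝ V] {R : RootSystemData V}

/-- Inductive form of the cascade of a set `S` of roots. -/
inductive InCascade (R : RootSystemData V) : Set V → V → Prop
  | head {S K : Set V} {β : V} (hK : IsComponent S K) (hβ : R.IsHighest K β) : InCascade R S β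
  | tail {S K : Set V} {γ β : V} (hK : IsComponent S K) (hγ : R.IsHighest K γ)
      (hβ : InCascade R (R.orth γ) β) : InCascade R S β

theorem inCascade_of_isChain {S : Set V} {b : V} {l : List V}
    (hhead : ∃ K, IsComponent S K ∧ R.IsHighest K b)
    (hl : (b :: l).IsChain fun γ δ => ∃ K, IsComponent (R.orth γ) K ∧ R.IsHighest K δ)
    {β : V} (hβ : β ∈ b :: l) : R.InCascade S β := by
  induction l generalizing S b with
  | nil =>
    obtain ⟨K, hK, hb⟩ := hhead
    rw [List.mem_singleton.1 hβ]
    exact .head hK hb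
  | cons c l ih =>
    obtain ⟨K, hK, hb⟩ := hhead
    rcases List.mem_cons.1 hβ with rfl | hβ
    · exact .head hK hb
    · rw [List.isChain_cons_cons] at hl
      exact .tail hK hb (ih hl.1 hl.2 hβ)

theorem InCascade.exists_isChain {S : Set V} {β : V} (h : R.InCascade S β) :
    ∃ b l, (∃ K, IsComponent S K ∧ R.IsHighest K b) ∧
      ((b :: l).IsChain fun γ δ => ∃ K, IsComponent (R.orth γ) K ∧ R.IsHighest K δ) ∧
      β ∈ b :: l := by
  induction h with
  | @head S K β hK hβ => exact ⟨β, [], ⟨K, hK, hβ⟩, by simp, by simp⟩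
  | @tail S K γ β hK hγ _ ih =>
    obtain ⟨b, l, h1, h2, h3⟩ := ih
    exact ⟨γ, b :: l, ⟨K, hK, hγ⟩, List.isChain_cons_cons.2 ⟨h1, h2⟩, List.mem_cons_of_mem _ h3⟩

theorem mem_cascade_iff {β : V} : β ∈ R.cascade ↔ R.InCascade R.Δ β := by
  constructor
  · rintro ⟨l, ⟨hne, hhead, hl⟩, hβ⟩
    obtain ⟨b, l, rfl⟩ := List.exists_cons_of_ne_nil hne
    exact inCascade_of_isChain (hhead b rfl) hl hβ
  · intro h
    obtain ⟨b, l, h1, h2, h3⟩ := h.exists_isChain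
    refine ⟨b :: l, ⟨by simp, ?_, h2⟩, h3⟩
    intro c hc
    obtain rfl : b = c := by simpa using hc
    exact h1

theorem InCascade.exists_facial {S : Set V} (hS : R.Facial S) {β : V} (h : R.InCascade S β) :
    ∃ F ⊆ S, R.Facial F ∧ R.IsHighest F β := by
  induction h with
  | head hK hβ => exact ⟨_, hK.1, hS.isComponent hK, hβ⟩
  | tail hK hγ _ ih =>
    have hF := hS.isComponent hK
    obtain ⟨F, h1, h2⟩ := ih (hF.orth hγ)
    exact ⟨F, h1.trans ((orth_subset hF hγ).trans hK.1), h2⟩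

theorem InCascade.sub_subset {S : Set V} (hS : R.Facial S) {β : V} (h : R.InCascade S β) :
    R.sub β ⊆ S := by
  obtain ⟨F, h1, h2, h3⟩ := h.exists_facial hS
  rwa [h3.sub_eq h2]

theorem InCascade.eq_of_mem_E {S : Set V} (hS : R.Facial S) {β γ φ : V}
    (hβ : R.InCascade S β) (hγ : R.InCascade S γ) (hφβ : φ ∈ R.E β) (hφγ : φ ∈ R.E γ) :
    β = γ := by
  induction hβ with
  | @head S K β hK hβ =>
    have hF := hS.isComponent hK
    cases hγ with
    | @head _ K' _ hK' hγ =>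
      have hF' := hS.isComponent hK'
      have := hK.eq_of_mem hK' (hβ.sub_eq hF ▸ hφβ.1) (hγ.sub_eq hF' ▸ hφγ.1)
      subst this
      exact hβ.unique hγ
    | @tail _ K' δ _ hK' hδ hγ =>
      have hF' := hS.isComponent hK'
      have hφδ := hγ.sub_subset (hF'.orth hδ) hφγ.1
      have := hK.eq_of_mem hK' (hβ.sub_eq hF ▸ hφβ.1) (orth_subset hF' hδ hφδ)
      subst this
      obtain rfl := hβ.unique hδ
      exact absurd hφδ.2 hφβ.2.ne'
  | @tail S K δ β hK hδ hβ ih =>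
    have hF := hS.isComponent hK
    have hφδ := hβ.sub_subset (hF.orth hδ) hφβ.1
    cases hγ with
    | @head _ K' _ hK' hγ =>
      have hF' := hS.isComponent hK'
      have := hK.eq_of_mem hK' (orth_subset hF hδ hφδ) (hγ.sub_eq hF' ▸ hφγ.1)
      subst this
      obtain rfl := hδ.unique hγ
      exact absurd hφδ.2 hφγ.2.ne'
    | @tail _ K' ε _ hK' hε hγ =>
      have hF' := hS.isComponent hK'
      have hφε := hγ.sub_subset (hF'.orth hε) hφγ.1
      have := hK.eq_of_mem hK' (orth_subset hF hδ hφδ) (orth_subset hF' hε hφε)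
      subst this
      obtain rfl := hδ.unique hε
      exact ih (hF.orth hδ) hγ hφβ

theorem Facial.exists_inCascade {S : Set V} (hS : R.Facial S) {φ : V} (hφ : φ ∈ R.Pos)
    (hφS : φ ∈ S) : ∃ β, R.InCascade S β ∧ φ ∈ R.E β := by
  have hfin : ∀ {S}, R.Facial S → S.Finite := fun hS => R.finite.subset hS.subset
  induction hn : S.ncard using Nat.strong_induction_on generalizing S with
  | _ n ih =>
    obtain ⟨K, hK, hφK⟩ := (hfin hS).exists_isComponent hφS
    have hF := hS.isComponent hK
    obtain ⟨β, hβ⟩ := hF.exists_isHighest hK.2.1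
    have h0 := hβ.isMaximalIn.inner_nonneg hF hφ hφK
    have hsub := hβ.sub_eq hF
    rw [real_inner_comm] at h0
    rcases h0.lt_or_eq with h0 | h0
    · exact ⟨β, .head hK hβ, hsub ▸ hφK, h0⟩
    · have hlt : (R.orth β).ncard < n := hn ▸ Set.ncard_lt_ncard
        ⟨(orth_subset hF hβ).trans hK.1, fun h =>
          (inner_self_pos_of_mem (hF.subset hβ.1)).ne' (h (hK.1 hβ.1)).2⟩ (hfin hS)
      obtain ⟨γ, hγ, hφγ⟩ := ih _ hlt (hF.orth hβ) ⟨hsub ▸ hφK, h0.symm⟩ rfl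
      exact ⟨γ, .tail hK hβ hγ, hφγ⟩

/-- The sets `E(β)` for `β` in the cascade cover the positive roots. -/
theorem exists_mem_cascade {φ : V} (hφ : φ ∈ R.Pos) : ∃ β ∈ R.cascade, φ ∈ R.E β := by
  obtain ⟨β, h1, h2⟩ := R.facial_Δ.exists_inCascade hφ (R.pos_subset hφ)
  exact ⟨β, mem_cascade_iff.2 h1, h2⟩

/-- The sets `E(β)` for `β` in the cascade are disjoint. -/
theorem cascade_eq_of_mem_E {β γ φ : V} (hβ : β ∈ R.cascade) (hγ : γ ∈ R.cascade)
    (hφβ : φ ∈ R.E β) (hφγ : φ ∈ R.E γ) : β = γ :=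
  (mem_cascade_iff.1 hβ).eq_of_mem_E R.facial_Δ (mem_cascade_iff.1 hγ) hφβ hφγ

theorem cascade_subset_pos (R : RootSystemData V) : R.cascade ⊆ R.Pos := fun _ hβ =>
  have ⟨_, _, _, h⟩ := (mem_cascade_iff.1 hβ).exists_facial R.facial_Δ
  h.2.1

theorem finite_cascade (R : RootSystemData V) : R.cascade.Finite :=
  R.finite_pos.subset R.cascade_subset_pos

theorem mem_E_self {β : V} (hβ : β ∈ R.cascade) : β ∈ R.E β := by
  obtain ⟨F, -, hF, h⟩ := (mem_cascade_iff.1 hβ).exists_facial R.facial_Δ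
  exact ⟨(h.sub_eq hF).symm ▸ h.1, inner_self_pos_of_mem (hF.subset h.1)⟩

theorem IsHighest.inner_pos_of_sub_pos {F : Set V} (hF : R.Facial F) {β φ : V}
    (hβ : R.IsHighest F β) (hφ : φ ∈ R.Pos) (hsub : β - φ ∈ R.Pos) : 0 < ⟪φ, β⟫_ℝ := by
  obtain ⟨hφF, hψF⟩ := hF.split φ hφ _ hsub (by rw [add_sub_cancel]; exact hβ.1)
  have h0 := hβ.isMaximalIn.inner_nonneg hF hφ hφF
  rw [real_inner_comm] at h0
  refine h0.lt_of_ne' fun h => hβ.isMaximalIn.add_notMem φ hφ (hF.add_mem_of_root hβ.1 hφF ?_)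
  have := sub_zsmul_mem (R.pos_subset hsub) (hF.subset hβ.1) (n := 2)
    (by rw [inner_sub_left, h]; push_cast; ring)
  convert R.neg_mem _ this using 1
  push_cast; module

/-- For `β` in the cascade, `φ ↦ β - φ` is an involution of `E(β) \ {β}`, which consists of the
positive roots `φ` such that `β - φ` is a positive root. -/
theorem sub_pos_iff_mem_E {β φ : V} (hβ : β ∈ R.cascade) (hφ : φ ∈ R.Pos) :
    β - φ ∈ R.Pos ↔ φ ∈ R.E β ∧ φ ≠ β := by
  obtain ⟨F, -, hF, h⟩ := (mem_cascade_iff.1 hβ).exists_facial R.facial_Δ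
  have hsub := h.sub_eq hF
  constructor
  · intro hpos
    refine ⟨⟨?_, h.inner_pos_of_sub_pos hF hφ hpos⟩, ?_⟩
    · rw [hsub]
      exact (hF.split φ hφ _ hpos (by rw [add_sub_cancel]; exact h.1)).1
    · rintro rfl
      rw [sub_self] at hpos
      exact R.zero_not_mem (R.pos_subset hpos)
  · rintro ⟨hφE, hne⟩
    have hmem := R.neg_mem _
      (sub_mem_of_inner_pos (R.pos_subset hφ) (hF.subset h.1) hne hφE.2)
    rw [neg_sub] at hmem
    refine (pos_or_neg_pos hmem).resolve_right fun hneg => neg_notMem_closure_pos hneg ?_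
    rw [neg_neg]
    exact nonnegComb_iff.1 (h.2.2 φ (hsub ▸ hφE.1))

end RootSystemData

namespace CascadeLieData

open RootSystemData

variable {V : Type*} [NormedAddCommGroup V] [InnerProductSpace ℝ V]
  {L : Type*} [LieRing L] [LieAlgebra ℂ L]
  {C : CascadeLieData V L}

theorem Φ_lie_eq_zero {φ β : V} (hφ : φ ∈ C.Pos) (hβ : β ∈ C.Pos) (h : β - φ ∉ C.Pos) :
    C.Φ ⁅C.e φ, C.e (-β)⁆ = 0 := by
  have hφΔ := C.pos_subset hφ
  have hβΔ := C.neg_mem β (C.pos_subset hβ)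
  by_cases h0 : φ + -β = 0
  · obtain rfl : φ = β := by rwa [← sub_eq_add_neg, sub_eq_zero] at h0
    exact C.Φ_b _ (Submodule.mem_sup_left (C.bracket_opp φ hφΔ))
  by_cases hΔ : φ + -β ∈ C.Δ
  · obtain ⟨c, -, hc⟩ := C.bracket_add φ hφΔ _ hβΔ hΔ
    have hpos : φ + -β ∈ C.Pos := (pos_or_neg_pos hΔ).resolve_right fun hn =>
      h (by rwa [neg_add, neg_neg, neg_add_eq_sub] at hn)
    rw [hc]
    exact C.Φ_b _ (Submodule.mem_sup_right
      (Submodule.smul_mem _ _ (Submodule.subset_span ⟨_, hpos, rfl⟩)))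
  · rw [C.bracket_zero φ hφΔ _ hβΔ hΔ h0, map_zero]

theorem exists_Φ_lie_eq_smul {φ β : V} (hφ : φ ∈ C.Pos) (hβ : β ∈ C.Pos) (h : β - φ ∈ C.Pos) :
    ∃ c : ℂ, c ≠ 0 ∧ C.Φ ⁅C.e φ, C.e (-β)⁆ = c • C.e (-(β - φ)) := by
  have heq : φ + -β = -(β - φ) := by abel
  obtain ⟨c, hc0, hc⟩ := C.bracket_add φ (C.pos_subset hφ) _ (C.neg_mem β (C.pos_subset hβ))
    (by rw [heq]; exact C.neg_mem _ (C.pos_subset h))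
  refine ⟨c, hc0, ?_⟩
  rw [hc, heq]
  exact C.Φ_neg _ (Submodule.smul_mem _ _ (Submodule.subset_span ⟨_, ⟨_, h, rfl⟩, rfl⟩))

/-- The coadjoint action `v ↦ Φ([v, τ])` on a fixed element `τ`. -/
def coadAt (C : CascadeLieData V L) (τ : L) : L →ₗ[ℂ] L where
  toFun v := C.Φ ⁅v, τ⁆
  map_add' v w := by rw [add_lie, map_add]
  map_smul' c v := by rw [smul_lie, map_smul, RingHom.id_apply]

@[simp]
theorem coadAt_apply (τ v : L) : C.coadAt τ v = C.Φ ⁅v, τ⁆ := rfl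

theorem coadAt_sum_apply (a : V → ℂ) (v : L) :
    C.coadAt (∑ᶠ β ∈ C.cascade, a β • C.e (-β)) v =
      ∑ β ∈ C.finite_cascade.toFinset, a β • C.Φ ⁅v, C.e (-β)⁆ := by
  rw [coadAt_apply, finsum_mem_eq_finite_toFinset_sum _ C.finite_cascade, lie_sum, map_sum]
  simp only [lie_smul, map_smul]

theorem coadAt_e_eq_zero (a : V → ℂ) {φ : V} (hφ : φ ∈ C.cascade) :
    C.coadAt (∑ᶠ β ∈ C.cascade, a β • C.e (-β)) (C.e φ) = 0 := by
  rw [coadAt_sum_apply]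
  refine Finset.sum_eq_zero fun β hβ => ?_
  have hβ : β ∈ C.cascade := by simpa using hβ
  have hφP := C.cascade_subset_pos hφ
  rw [Φ_lie_eq_zero hφP (C.cascade_subset_pos hβ), smul_zero]
  intro h
  obtain ⟨hE, hne⟩ := (sub_pos_iff_mem_E hβ hφP).1 h
  exact hne (cascade_eq_of_mem_E hφ hβ (mem_E_self hφ) hE)

theorem exists_coadAt_e_eq_smul {a : V → ℂ} (ha : ∀ β ∈ C.cascade, a β ≠ 0) {φ : V}
    (hφ : φ ∈ C.Pos \ C.cascade) :
    ∃ β ∈ C.cascade, β - φ ∈ C.Pos ∧ ∃ c : ℂ, c ≠ 0 ∧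
      C.coadAt (∑ᶠ β ∈ C.cascade, a β • C.e (-β)) (C.e φ) = c • C.e (-(β - φ)) := by
  obtain ⟨β, hβ, hE⟩ := exists_mem_cascade hφ.1
  have hpos := (sub_pos_iff_mem_E hβ hφ.1).2 ⟨hE, fun h => hφ.2 (h ▸ hβ)⟩
  obtain ⟨c, hc0, hc⟩ := exists_Φ_lie_eq_smul hφ.1 (C.cascade_subset_pos hβ) hpos
  refine ⟨β, hβ, hpos, a β * c, mul_ne_zero (ha β hβ) hc0, ?_⟩
  rw [coadAt_sum_apply, Finset.sum_eq_single β, hc, smul_smul]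
  · intro γ hγ hne
    have hγ : γ ∈ C.cascade := by simpa using hγ
    rw [Φ_lie_eq_zero hφ.1 (C.cascade_subset_pos hγ), smul_zero]
    exact fun h => hne (cascade_eq_of_mem_E hγ hβ ((sub_pos_iff_mem_E hγ hφ.1).1 h).1 hE)
  · exact fun h => absurd (by simpa using hβ) h

theorem linearIndependent_coadAt_e {a : V → ℂ} (ha : ∀ β ∈ C.cascade, a β ≠ 0) :
    LinearIndependent ℂ fun φ : ↥(C.Pos \ C.cascade) =>
      C.coadAt (∑ᶠ β ∈ C.cascade, a β • C.e (-β)) (C.e φ) := by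
  choose b hb hpos c hc0 hc using fun φ : ↥(C.Pos \ C.cascade) => exists_coadAt_e_eq_smul ha φ.2
  let f : ↥(C.Pos \ C.cascade) → C.Δ := fun φ =>
    ⟨-(b φ - φ), C.neg_mem _ (C.pos_subset (hpos φ))⟩
  have hf : Function.Injective f := by
    intro φ ψ h
    have h1 : b φ - φ = b ψ - ψ := neg_injective (congrArg Subtype.val h)
    have hE : ∀ φ, b φ - φ ∈ C.E (b φ) := fun φ =>
      ((sub_pos_iff_mem_E (hb φ) (hpos φ)).1 (by rw [sub_sub_cancel]; exact φ.2.1)).1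
    have h2 : b φ = b ψ := cascade_eq_of_mem_E (hb φ) (hb ψ) (hE φ) (h1 ▸ hE ψ)
    rw [h2] at h1
    exact Subtype.ext (sub_right_injective h1)
  convert (C.indep.comp f hf).units_smul fun φ => Units.mk0 (c φ) (hc0 φ) using 1
  ext φ
  exact hc φ

theorem nSub_eq_sup (C : CascadeLieData V L) : C.nSub = C.rSub ⊔ C.sSub := by
  rw [nSub, rSub, sSub, ← Submodule.span_union, ← Set.image_union,
    Set.union_sdiff_cancel C.cascade_subset_pos]

theorem rSub_le_ker (a : V → ℂ) :
    C.rSub ≤ LinearMap.ker (C.coadAt (∑ᶠ β ∈ C.cascade, a β • C.e (-β))) := by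
  refine Submodule.span_le.2 ?_
  rintro _ ⟨φ, hφ, rfl⟩
  exact coadAt_e_eq_zero a hφ

theorem disjoint_sSub_ker {a : V → ℂ} (ha : ∀ β ∈ C.cascade, a β ≠ 0) :
    Disjoint C.sSub (LinearMap.ker (C.coadAt (∑ᶠ β ∈ C.cascade, a β • C.e (-β)))) := by
  have h := Submodule.range_ker_disjoint (v := fun φ : ↥(C.Pos \ C.cascade) => C.e φ)
    (linearIndependent_coadAt_e ha)
  rwa [← Function.comp_def C.e, Set.range_comp, Subtype.range_coe] at h

end CascadeLieData

/-- For every `τ ∈ 𝔯₋ˣ`, the coadjoint isotropy subalgebra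
`𝔫_τ = {v ∈ 𝔫 : Φ([v,τ]) = 0}` equals `𝔯`; in particular it is independent of `τ`. -/
theorem statement12 {V : Type*} [NormedAddCommGroup V] [InnerProductSpace ℝ V]
    {L : Type*} [LieRing L] [LieAlgebra ℂ L] [Module.Finite ℂ L]
    (C : CascadeLieData V L) (τ : L) (hτ : τ ∈ C.rMinusX) :
    {v : L | v ∈ C.nSub ∧ C.Φ ⁅v, τ⁆ = 0} = {v : L | v ∈ C.rSub} := by
  obtain ⟨a, ha, rfl⟩ := hτ
  ext v
  constructor
  · rintro ⟨hv, hker⟩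
    rw [C.nSub_eq_sup] at hv
    obtain ⟨r, hr, s, hs, rfl⟩ := Submodule.mem_sup.1 hv
    have hs0 : s = 0 := Submodule.disjoint_def.1 (CascadeLieData.disjoint_sSub_ker ha) s hs
      ((Submodule.add_mem_iff_right _ (CascadeLieData.rSub_le_ker a hr)).1 hker)
    rw [hs0, add_zero]
    exact hr
  · intro hv
    exact ⟨C.nSub_eq_sup ▸ Submodule.mem_sup_left hv, CascadeLieData.rSub_le_ker a hv⟩
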